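/- Suppose Assumption (H) holds and fix r > 0. For every S ≥ 0 there exist constants ρ_max ≥ ρ_min > 0 (depending only on S, r and ρ*) with the following property: for every a, b ∈ ℝ with a < b, every positive continuous function ρ on [a,b] belonging to H¹(a,b), and every continuous function v on [a,b] with ∫_a^b ρ(x)dx = 1 and V(a,b,ρ,v) ≤ S, one has ρ_min ≤ ρ(x) ≤ ρ_max for all x ∈ [a,b]. -/

import Mathlib

open MeasureTheory Set Filter

/-- `Q(ρ) = ρ ∫_{ρ*}^{ρ} P(τ)/τ² dτ − (P(ρ*)/ρ*)ρ + P(ρ*)`. -/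
noncomputable def Qf (P : ℝ → ℝ) (ρs x : ℝ) : ℝ :=
  x * (∫ τ in ρs..x, P τ / τ ^ 2) - (P ρs / ρs) * x + P ρs

/-- `k(ρ) = ∫_{ρ*}^{ρ} μ(τ)/τ dτ`. -/
noncomputable def kf (μ : ℝ → ℝ) (ρs x : ℝ) : ℝ :=
  ∫ τ in ρs..x, μ τ / τ

/-- `G(ρ) = ∫_{ρ*}^{ρ} μ(l) l^{-3/2} √(Q(l)) dl`. -/
noncomputable def Gf (P μ : ℝ → ℝ) (ρs x : ℝ) : ℝ :=
  ∫ l in ρs..x, μ l / l ^ ((3 : ℝ) / 2) * Real.sqrt (Qf P ρs l)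

/-- Assumption (H): `G(ρ) → +∞` as `ρ → +∞`, `G(ρ) → −∞` as `ρ → 0⁺`,
and `k(ρ) → +∞` as `ρ → +∞`. -/
def AssumpH (P μ : ℝ → ℝ) (ρs : ℝ) : Prop :=
  Tendsto (Gf P μ ρs) atTop atTop ∧
  Tendsto (Gf P μ ρs) (nhdsWithin 0 (Ioi 0)) atBot ∧
  Tendsto (kf μ ρs) atTop atTop

/-- Potential energy `U(a,b,ρ) = ∫_a^b Q(ρ(x)) dx`. -/
noncomputable def Uf (P : ℝ → ℝ) (ρs a b : ℝ) (ρ : ℝ → ℝ) : ℝ :=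
  ∫ x in a..b, Qf P ρs (ρ x)

/-- Total mechanical energy `E`. -/
noncomputable def Ef (P : ℝ → ℝ) (ρs a b : ℝ) (ρ v : ℝ → ℝ) : ℝ :=
  (v a) ^ 2 / 2 + (v b) ^ 2 / 2 + (1 / 2) * (∫ x in a..b, ρ x * (v x) ^ 2)
    + Uf P ρs a b ρ

/-- Transformed energy `W`. -/
noncomputable def Wf (P μ : ℝ → ℝ) (ρs a b : ℝ) (ρ ρx v : ℝ → ℝ) : ℝ :=
  (1 / 2) * (∫ x in a..b, (ρ x)⁻¹ * (ρ x * v x + μ (ρ x) * (ρ x)⁻¹ * ρx x) ^ 2)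
    + (1 / 2) * (v b - kf μ ρs (ρ b)) ^ 2
    + (1 / 2) * (v a + kf μ ρs (ρ a)) ^ 2
    + Uf P ρs a b ρ

/-- Control Lyapunov functional `V = W + r E`. -/
noncomputable def Vf (P μ : ℝ → ℝ) (ρs r a b : ℝ) (ρ ρx v : ℝ → ℝ) : ℝ :=
  Wf P μ ρs a b ρ ρx v + r * Ef P ρs a b ρ v

/-- `f ∈ H¹(a,b)` with weak derivative `f'`:  `f' ∈ L¹ ∩ L²(a,b)` and
`f(x) = f(a) + ∫_a^x f'(s) ds` on `[a,b]`. -/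
def H1On (a b : ℝ) (f f' : ℝ → ℝ) : Prop :=
  IntervalIntegrable f' volume a b ∧
  IntervalIntegrable (fun s => (f' s) ^ 2) volume a b ∧
  ∀ x ∈ Icc a b, f x = f a + ∫ s in a..x, f' s

lemma ac_comp {F G : ℝ → ℝ} {a b : ℝ} {s : Set ℝ} {K : NNReal}
    (hG : LipschitzOnWith K G s) (hF : AbsolutelyContinuousOnInterval F a b)
    (hs : ∀ x ∈ uIcc a b, F x ∈ s) :
    AbsolutelyContinuousOnInterval (fun x => G (F x)) a b := by
  rw [absolutelyContinuousOnInterval_iff] at hF ⊢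
  intro ε hε
  obtain ⟨δ, hδ, h⟩ := hF (ε / (K + 1)) (by positivity)
  refine ⟨δ, hδ, fun E hE hlen => ?_⟩
  have h1 := h E hE hlen
  calc _ ≤ ∑ i ∈ Finset.range E.1, (K : ℝ) * dist (F (E.2 i).1) (F (E.2 i).2) := by
        apply Finset.sum_le_sum
        intro i hi
        have := hE.1 i hi
        exact hG.dist_le_mul _ (hs _ this.1) _ (hs _ this.2)
    _ = K * ∑ i ∈ Finset.range E.1, dist (F (E.2 i).1) (F (E.2 i).2) := by
        rw [Finset.mul_sum]
    _ ≤ K * (ε / (K + 1)) := by gcongr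
    _ < ε := by
        rw [mul_div_assoc', div_lt_iff₀ (by positivity)]
        nlinarith

lemma chain_int {a b : ℝ} (hab : a < b) {f f' g G : ℝ → ℝ}
    (hf' : IntervalIntegrable f' volume a b)
    (hf : ∀ x ∈ Icc a b, f x = f a + ∫ s in a..x, f' s)
    (hpos : ∀ x ∈ Icc a b, 0 < f x) (hg : ContinuousOn g (Ioi 0))
    (hG : ∀ t, 0 < t → HasDerivAt G (g t) t)
    {x y : ℝ} (hx : x ∈ Icc a b) (hy : y ∈ Icc a b) (hxy : x ≤ y) :
    G (f y) - G (f x) = ∫ s in x..y, g (f s) * f' s := by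
  set F : ℝ → ℝ := fun x => f a + ∫ s in a..x, f' s with hFdef
  have hFf : ∀ x ∈ Icc a b, f x = F x := hf
  have hFac0 : AbsolutelyContinuousOnInterval (fun x => ∫ s in a..x, f' s) a b :=
    hf'.absolutelyContinuousOnInterval_intervalIntegral (by simp)
  have hFac : AbsolutelyContinuousOnInterval F a b := by
    have hc : AbsolutelyContinuousOnInterval (fun _ : ℝ => f a) a b :=
      (LipschitzWith.const (f a)).lipschitzOnWith.absolutelyContinuousOnInterval
    exact hc.add hFac0
  have hsub : Icc x y ⊆ Icc a b := Icc_subset_Icc hx.1 hy.2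
  have hFc : ContinuousOn F (Icc a b) := by
    have := hFac.continuousOn
    rwa [uIcc_of_le hab.le] at this
  -- range
  obtain ⟨m, hm, hmin⟩ := isCompact_Icc.exists_isMinOn (nonempty_Icc.2 hab.le) hFc
  obtain ⟨M, hM, hmax⟩ := isCompact_Icc.exists_isMaxOn (nonempty_Icc.2 hab.le) hFc
  have hmpos : 0 < F m := by rw [← hFf m hm]; exact hpos m hm
  have hss : Icc (F m) (F M) ⊆ Ioi 0 := fun t ht => lt_of_lt_of_le hmpos ht.1
  obtain ⟨C, hC⟩ := isCompact_Icc.exists_bound_of_continuousOn (hg.mono hss)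
  have hLip : LipschitzOnWith (Real.toNNReal C) G (Icc (F m) (F M)) := by
    apply (convex_Icc _ _).lipschitzOnWith_of_nnnorm_hasDerivWithin_le (f' := g)
    · intro t ht
      exact (hG t (hss ht)).hasDerivWithinAt
    · intro t ht
      have := hC t ht
      rw [← NNReal.coe_le_coe]
      simpa using Or.inl this
  have hGF : AbsolutelyContinuousOnInterval (fun x => G (F x)) a b := by
    apply ac_comp hLip hFac
    intro t ht
    rw [uIcc_of_le hab.le] at ht
    exact ⟨hmin ht, hmax ht⟩
  have hGF' := hGF.mono (c := x) (d := y) (by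
    rw [uIcc_of_le hab.le, uIcc_of_le hxy]; exact hsub)
  rw [hFf x hx, hFf y hy, ← hGF'.integral_deriv_eq_sub]
  apply intervalIntegral.integral_congr_ae
  filter_upwards [hf'.ae_hasDerivAt_integral] with t ht htm
  rw [uIoc_of_le hxy] at htm
  have htI : t ∈ Icc a b := hsub ⟨htm.1.le, htm.2⟩
  have hd := ht (by rwa [uIcc_of_le hab.le]) a (by simp)
  have hdF : HasDerivAt F (f' t) t := hd.const_add (f a)
  have hp : 0 < F t := by rw [← hFf t htI]; exact hpos t htI
  have hh : HasDerivAt (fun x => G (F x)) (g (F t) * f' t) t := (hG _ hp).comp t hdF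
  rw [hh.deriv, hFf t htI]

lemma hasDerivAt_prim {g : ℝ → ℝ} (hg : ContinuousOn g (Ioi 0)) {c t : ℝ} (hc : 0 < c)
    (ht : 0 < t) : HasDerivAt (fun x => ∫ s in c..x, g s) (g t) t := by
  have hsub : uIcc c t ⊆ Ioi 0 := fun z hz => lt_of_lt_of_le (lt_min hc ht) hz.1
  have hn : Ioi (0:ℝ) ∈ nhds t := Ioi_mem_nhds ht
  exact intervalIntegral.integral_hasDerivAt_right (hg.mono hsub).intervalIntegrable
    (hg.stronglyMeasurableAtFilter isOpen_Ioi t ht) (hg.continuousAt hn)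

lemma Qf_eq {P : ℝ → ℝ} (hP : ContinuousOn P (Ioi 0)) {ρs x : ℝ} (hs : 0 < ρs) (hx : 0 < x) :
    Qf P ρs x = x * ∫ τ in ρs..x, (P τ - P ρs) / τ ^ 2 := by
  have hsub : uIcc ρs x ⊆ Ioi 0 := fun z hz => lt_of_lt_of_le (lt_min hs hx) hz.1
  have hne : ∀ z ∈ uIcc ρs x, z ^ 2 ≠ 0 := fun z hz => pow_ne_zero 2 (ne_of_gt (hsub hz))
  have hc2 : ContinuousOn (fun z : ℝ => z ^ 2) (uIcc ρs x) := by fun_prop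
  have h1 : IntervalIntegrable (fun τ => P τ / τ ^ 2) volume ρs x :=
    ((hP.mono hsub).div hc2 hne).intervalIntegrable
  have h2 : IntervalIntegrable (fun τ => P ρs / τ ^ 2) volume ρs x :=
    (continuousOn_const.div hc2 hne).intervalIntegrable
  have h3 : ∫ τ in ρs..x, P ρs / τ ^ 2 = (- P ρs / x) - (- P ρs / ρs) := by
    apply intervalIntegral.integral_eq_sub_of_hasDerivAt (f := fun z => - P ρs / z) _ h2
    intro z hz
    have hz0 : z ≠ 0 := ne_of_gt (hsub hz)
    have := (hasDerivAt_inv hz0).const_mul (- P ρs)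
    simpa [div_eq_mul_inv] using this
  have h4 : ∫ τ in ρs..x, (P τ - P ρs) / τ ^ 2
      = (∫ τ in ρs..x, P τ / τ ^ 2) - ∫ τ in ρs..x, P ρs / τ ^ 2 := by
    rw [← intervalIntegral.integral_sub h1 h2]
    congr 1; ext τ; ring
  rw [h4, h3, Qf]
  field_simp
  ring

lemma Qf_nonneg {P : ℝ → ℝ} (hP : ContinuousOn P (Ioi 0)) (hmono : MonotoneOn P (Ioi 0))
    {ρs x : ℝ} (hs : 0 < ρs) (hx : 0 < x) : 0 ≤ Qf P ρs x := by
  rw [Qf_eq hP hs hx]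
  apply mul_nonneg hx.le
  rcases le_total ρs x with h | h
  · apply intervalIntegral.integral_nonneg h
    intro u hu
    have : P ρs ≤ P u := hmono hs (lt_of_lt_of_le hs hu.1) hu.1
    exact div_nonneg (by linarith) (sq_nonneg _)
  · rw [intervalIntegral.integral_symm, ← intervalIntegral.integral_neg]
    apply intervalIntegral.integral_nonneg h
    intro u hu
    have : P u ≤ P ρs := hmono (lt_of_lt_of_le hx hu.1) hs hu.2
    rw [← neg_div]
    exact div_nonneg (by linarith) (sq_nonneg _)

lemma Qf_cont {P : ℝ → ℝ} (hP : ContinuousOn P (Ioi 0)) {ρs : ℝ} (hs : 0 < ρs) :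
    ContinuousOn (Qf P ρs) (Ioi 0) := by
  have hg : ContinuousOn (fun τ => P τ / τ ^ 2) (Ioi 0) :=
    hP.div (by fun_prop) fun z hz => pow_ne_zero 2 (ne_of_gt hz)
  have h1 : ContinuousOn (fun x => ∫ τ in ρs..x, P τ / τ ^ 2) (Ioi 0) := fun t ht =>
    (hasDerivAt_prim hg hs ht).continuousAt.continuousWithinAt
  unfold Qf
  fun_prop

lemma Qf_large {P : ℝ → ℝ} (hP : ContinuousOn P (Ioi 0)) (hmono : StrictMonoOn P (Ioi 0))
    {ρs : ℝ} (hs : 0 < ρs) (A : ℝ) : ∃ ε, 0 < ε ∧ ∀ x, 0 < x → x < ε → A * x ≤ Qf P ρs x := by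
  set h := ρs / 2 with hh
  have hpos : 0 < h := by positivity
  have hlt : h < ρs := by simp [hh]; linarith
  set d := P ρs - P h with hd
  have hdpos : 0 < d := sub_pos.2 (hmono hpos hs hlt)
  refine ⟨min h (1 / (1 / h + |A| / d)), by positivity, fun x hx hxε => ?_⟩
  have hxh : x < h := lt_of_lt_of_le hxε (min_le_left _ _)
  have hx2 : x < 1 / (1 / h + |A| / d) := lt_of_lt_of_le hxε (min_le_right _ _)
  have hx3 : 1 / h + |A| / d ≤ 1 / x := by
    rw [lt_div_iff₀ (by positivity)] at hx2
    rw [le_div_iff₀ hx]; linarith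
  -- compare
  rw [Qf_eq hP hs hx, mul_comm]
  apply mul_le_mul_of_nonneg_left _ hx.le
  have hI : ∀ p q : ℝ, 0 < p → p ≤ q → IntervalIntegrable (fun τ => (P ρs - P τ) / τ ^ 2) volume p q := by
    intro p q hp hpq
    have hsub : uIcc p q ⊆ Ioi 0 := by
      rw [uIcc_of_le hpq]; exact fun z hz => lt_of_lt_of_le hp hz.1
    exact ((continuousOn_const.sub (hP.mono hsub)).div (by fun_prop)
      fun z hz => pow_ne_zero 2 (ne_of_gt (hsub hz))).intervalIntegrable
  have e1 : ∫ τ in ρs..x, (P τ - P ρs) / τ ^ 2 = ∫ τ in x..ρs, (P ρs - P τ) / τ ^ 2 := by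
    rw [intervalIntegral.integral_symm, ← intervalIntegral.integral_neg]
    congr 1; ext τ; ring
  have e2 := intervalIntegral.integral_add_adjacent_intervals (hI x h hx hxh.le) (hI h ρs hpos hlt.le)
  have e3 : 0 ≤ ∫ τ in h..ρs, (P ρs - P τ) / τ ^ 2 := by
    apply intervalIntegral.integral_nonneg hlt.le
    intro u hu
    have : P u ≤ P ρs := hmono.monotoneOn (lt_of_lt_of_le hpos hu.1) hs hu.2
    exact div_nonneg (by linarith) (sq_nonneg _)
  have hsub : uIcc x h ⊆ Ioi 0 := by
      rw [uIcc_of_le hxh.le]; exact fun z hz => lt_of_lt_of_le hx hz.1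
  have h2 : IntervalIntegrable (fun τ => d / τ ^ 2) volume x h :=
    (continuousOn_const.div (by fun_prop)
      fun z hz => pow_ne_zero 2 (ne_of_gt (hsub hz))).intervalIntegrable
  have e4 : ∫ τ in x..h, d / τ ^ 2 = (- d / h) - (- d / x) := by
    apply intervalIntegral.integral_eq_sub_of_hasDerivAt (f := fun z => - d / z) _ h2
    intro z hz
    have hz0 : z ≠ 0 := ne_of_gt (hsub hz)
    have := (hasDerivAt_inv hz0).const_mul (- d)
    simpa [div_eq_mul_inv] using this
  have e5 : ∫ τ in x..h, d / τ ^ 2 ≤ ∫ τ in x..h, (P ρs - P τ) / τ ^ 2 := by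
    apply intervalIntegral.integral_mono_on hxh.le h2 (hI x h hx hxh.le)
    intro u hu
    have : P u ≤ P h := hmono.monotoneOn (lt_of_lt_of_le hx hu.1) hpos hu.2
    simp only [hd]; gcongr
  have e6 : |A| ≤ (- d / h) - (- d / x) := by
    have := mul_le_mul_of_nonneg_left hx3 hdpos.le
    have e : d * (1 / h + |A| / d) = d / h + |A| := by field_simp
    rw [e] at this
    have e' : d * (1 / x) = d / x := by ring
    rw [e'] at this
    rw [neg_div, neg_div]; linarith
  rw [e1]
  linarith [le_abs_self A]

/-- **Lemma 1 of the paper.**  Under Assumption (H), for every `S ≥ 0` there are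
constants `0 < ρ_min ≤ ρ_max` such that every static configuration `(a, b, ρ, v)`
with unit total mass and Lyapunov value `V(a,b,ρ,v) ≤ S` has its density pinched:
`ρ_min ≤ ρ(x) ≤ ρ_max` on `[a,b]`. -/
theorem density_pinching_from_CLF
    (P μ P' : ℝ → ℝ) (Pext ρs : ℝ)
    (hP : ContDiffOn ℝ 2 P (Ioi 0)) (hμ : ContDiffOn ℝ 2 μ (Ioi 0))
    (hPpos : ∀ x, 0 < x → 0 < P x) (hμpos : ∀ x, 0 < x → 0 < μ x)
    (hP' : ∀ x, 0 < x → HasDerivAt P (P' x) x)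
    (hP'pos : ∀ x, 0 < x → 0 < P' x)
    (hPrange : P '' Ioi 0 = Ioi 0)
    (hPext : 0 < Pext) (hρs : 0 < ρs) (hPρs : P ρs = Pext)
    (hH : AssumpH P μ ρs)
    (r : ℝ) (hr : 0 < r) (S : ℝ) (hS : 0 ≤ S) :
    ∃ ρmin ρmax : ℝ, 0 < ρmin ∧ ρmin ≤ ρmax ∧
      ∀ (a b : ℝ) (ρ ρx v : ℝ → ℝ), a < b →
        ContinuousOn ρ (Icc a b) → (∀ x ∈ Icc a b, 0 < ρ x) →
        H1On a b ρ ρx →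
        ContinuousOn v (Icc a b) →
        (∫ x in a..b, ρ x) = 1 →
        Vf P μ ρs r a b ρ ρx v ≤ S →
        ∀ x ∈ Icc a b, ρmin ≤ ρ x ∧ ρ x ≤ ρmax := by
  have hPc : ContinuousOn P (Ioi 0) := hP.continuousOn
  have hμc : ContinuousOn μ (Ioi 0) := hμ.continuousOn
  have hmono : StrictMonoOn P (Ioi 0) := by
    apply strictMonoOn_of_deriv_pos (convex_Ioi 0) hPc
    intro x hx
    rw [interior_Ioi] at hx
    rw [(hP' x hx).deriv]
    exact hP'pos x hx
  have hQc := Qf_cont hPc hρs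
  have hQ0 : ∀ x, 0 < x → 0 ≤ Qf P ρs x := fun x hx => Qf_nonneg hPc hmono.monotoneOn hρs hx
  set g : ℝ → ℝ := fun l => μ l / l ^ ((3 : ℝ) / 2) * Real.sqrt (Qf P ρs l) with hgdef
  have hgc : ContinuousOn g (Ioi 0) := by
    apply ContinuousOn.mul
    · apply hμc.div
      · exact continuousOn_id.rpow_const (fun x hx => Or.inl (ne_of_gt hx))
      · intro x hx
        exact (Real.rpow_pos_of_pos hx _).ne'
    · exact hQc.sqrt
  have hg0 : ∀ x, 0 < x → 0 ≤ g x := fun x hx =>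
    mul_nonneg (div_nonneg (hμpos x hx).le (Real.rpow_nonneg hx.le _)) (Real.sqrt_nonneg _)
  have hGd : ∀ t, 0 < t → HasDerivAt (Gf P μ ρs) (g t) t := fun t ht =>
    hasDerivAt_prim hgc hρs ht
  have hGmono : MonotoneOn (Gf P μ ρs) (Ioi 0) := by
    apply monotoneOn_of_deriv_nonneg (convex_Ioi 0)
    · exact fun t ht => (hGd t ht).continuousAt.continuousWithinAt
    · intro t ht
      rw [interior_Ioi] at ht
      exact (hGd t ht).differentiableAt.differentiableWithinAt
    · intro t ht
      rw [interior_Ioi] at ht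
      rw [(hGd t ht).deriv]; exact hg0 t ht
  obtain ⟨hG1, hG2, hk⟩ := hH
  -- constants
  obtain ⟨ε, hε, hεQ⟩ := Qf_large hPc hmono hρs (S + 1)
  set K : ℝ := 2 * S + 2 * S / r + S with hK
  obtain ⟨R, hR⟩ := eventually_atTop.1
    (hk.eventually_gt_atTop (2 * S + 1 + (2 * S / r + 1)))
  set R' := max R 1 with hR'
  have hR'0 : 0 < R' := lt_of_lt_of_le one_pos (le_max_right _ _)
  obtain ⟨M, hM⟩ := eventually_atTop.1 (hG1.eventually_gt_atTop (Gf P μ ρs R' + K))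
  have h2 := hG2.eventually (eventually_lt_atBot (Gf P μ ρs ε - K))
  obtain ⟨δ, hδ, hδG⟩ := (mem_nhdsGT_iff_exists_Ioo_subset (a := (0:ℝ))).1 h2
  have hδ : 0 < δ := hδ
  have hM'0 : 0 < max M 1 := lt_of_lt_of_le one_pos (le_max_right _ _)
  refine ⟨min δ (max M 1), max M 1, lt_min hδ hM'0, min_le_right _ _, ?_⟩
  intro a b ρ ρx v hab hρc hρ0 hH1 hvc hmass hV
  obtain ⟨hx1, hx2, hxf⟩ := hH1
  -- basic continuity
  have hu : uIcc a b = Icc a b := uIcc_of_le hab.le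
  have hmaps : MapsTo ρ (Icc a b) (Ioi 0) := hρ0
  have hμρ : ContinuousOn (fun x => μ (ρ x)) (Icc a b) := hμc.comp hρc hmaps
  have hQρ : ContinuousOn (fun x => Qf P ρs (ρ x)) (Icc a b) := hQc.comp hρc hmaps
  have hρi : ContinuousOn (fun x => (ρ x)⁻¹) (Icc a b) :=
    hρc.inv₀ fun x hx => (hρ0 x hx).ne'
  have iQ : IntervalIntegrable (fun x => Qf P ρs (ρ x)) volume a b :=
    ContinuousOn.intervalIntegrable (by rwa [hu])
  have iv : IntervalIntegrable (fun x => ρ x * v x ^ 2) volume a b := by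
    apply ContinuousOn.intervalIntegrable; rw [hu]; fun_prop
  have iw : IntervalIntegrable
      (fun x => (ρ x)⁻¹ * (ρ x * v x + μ (ρ x) * (ρ x)⁻¹ * ρx x) ^ 2) volume a b := by
    have c1 : ContinuousOn (fun x => (ρ x)⁻¹ * (ρ x * v x) ^ 2) (uIcc a b) := by
      rw [hu]; fun_prop
    have c2 : ContinuousOn (fun x => 2 * (ρ x)⁻¹ * (ρ x * v x) * (μ (ρ x) * (ρ x)⁻¹))
        (uIcc a b) := by
      rw [hu]; fun_prop
    have c3 : ContinuousOn (fun x => (ρ x)⁻¹ * (μ (ρ x) * (ρ x)⁻¹) ^ 2) (uIcc a b) := by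
      rw [hu]; fun_prop
    have := (c1.intervalIntegrable.add (hx1.continuousOn_mul c2)).add (hx2.continuousOn_mul c3)
    refine this.congr ?_
    intro x _
    ring
  -- energy consequences
  have U0 : 0 ≤ ∫ x in a..b, Qf P ρs (ρ x) :=
    intervalIntegral.integral_nonneg hab.le fun x hx => hQ0 _ (hρ0 x hx)
  have E0 : 0 ≤ ∫ x in a..b, ρ x * v x ^ 2 :=
    intervalIntegral.integral_nonneg hab.le fun x hx => mul_nonneg (hρ0 x hx).le (sq_nonneg _)
  have W0 : 0 ≤ ∫ x in a..b, (ρ x)⁻¹ * (ρ x * v x + μ (ρ x) * (ρ x)⁻¹ * ρx x) ^ 2 :=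
    intervalIntegral.integral_nonneg hab.le fun x hx =>
      mul_nonneg (inv_nonneg.2 (hρ0 x hx).le) (sq_nonneg _)
  simp only [Vf, Wf, Ef, Uf] at hV
  set IU := ∫ x in a..b, Qf P ρs (ρ x) with hIU
  set IE := ∫ x in a..b, ρ x * v x ^ 2 with hIE
  set IW := ∫ x in a..b, (ρ x)⁻¹ * (ρ x * v x + μ (ρ x) * (ρ x)⁻¹ * ρx x) ^ 2 with hIW
  have q1 : 0 ≤ r * (v a ^ 2 / 2) := by positivity
  have q2 : 0 ≤ r * (v b ^ 2 / 2) := by positivity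
  have q3 : 0 ≤ r * (1 / 2 * IE) := by positivity
  have q4 : 0 ≤ r * IU := by positivity
  have q5 := sq_nonneg (v b - kf μ ρs (ρ b))
  have q6 := sq_nonneg (v a + kf μ ρs (ρ a))
  have hV' : 1 / 2 * IW + 1 / 2 * (v b - kf μ ρs (ρ b)) ^ 2 + 1 / 2 * (v a + kf μ ρs (ρ a)) ^ 2
      + IU + (r * (v a ^ 2 / 2) + r * (v b ^ 2 / 2) + r * (1 / 2 * IE) + r * IU) ≤ S := by
    linarith
  have bU : IU ≤ S := by linarith
  have bW : IW ≤ 2 * S := by linarith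
  have bE : IE ≤ 2 * S / r := by
    rw [le_div_iff₀ hr]; linarith
  have bvb : v b ^ 2 ≤ 2 * S / r := by
    rw [le_div_iff₀ hr]; linarith
  have hvS : 0 ≤ 2 * S / r := by positivity
  have bkb : (v b - kf μ ρs (ρ b)) ^ 2 ≤ 2 * S := by linarith
  -- oscillation
  have key : ∀ x ∈ Icc a b, ∀ y ∈ Icc a b, x ≤ y →
      |Gf P μ ρs (ρ y) - Gf P μ ρs (ρ x)| ≤ K := by
    intro x hx y hy hxy
    rw [chain_int hab hx1 hxf hρ0 hgc hGd hx hy hxy]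
    have hsub : Icc x y ⊆ Icc a b := Icc_subset_Icc hx.1 hy.2
    set B : ℝ → ℝ := fun s => (ρ s)⁻¹ * (ρ s * v s + μ (ρ s) * (ρ s)⁻¹ * ρx s) ^ 2
      + ρ s * v s ^ 2 + Qf P ρs (ρ s) with hB
    have iB : IntervalIntegrable B volume a b := (iw.add iv).add iQ
    have B0 : ∀ s ∈ Icc a b, 0 ≤ B s := by
      intro s hs
      have h1 := hρ0 s hs
      have h2 := hQ0 _ h1
      simp only [hB]; positivity
    have hpt : ∀ s ∈ Icc a b, |g (ρ s) * ρx s| ≤ B s := by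
      intro s hs
      have h1 := hρ0 s hs
      have h2 := hQ0 _ h1
      set p := ρ s
      set q := Real.sqrt (Qf P ρs p) with hq
      have hqq : q ^ 2 = Qf P ρs p := Real.sq_sqrt h2
      set c := p ^ ((3 : ℝ) / 2) with hc
      have hc0 : 0 < c := Real.rpow_pos_of_pos h1 _
      have hcc : c ^ 2 = p ^ 3 := by
        rw [hc, ← Real.rpow_natCast, ← Real.rpow_mul h1.le, ← Real.rpow_natCast]
        norm_num
      set w := μ p * p⁻¹ * ρx s with hw
      set z := μ p / c * ρx s with hz
      have hzz : z ^ 2 = p⁻¹ * w ^ 2 := by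
        have : z ^ 2 = μ p ^ 2 / c ^ 2 * ρx s ^ 2 := by rw [hz]; field_simp
        rw [this, hcc, hw]; field_simp
      have e1 : g p * ρx s = z * q := by simp only [hgdef, hz]; ring
      have e2 : p⁻¹ * w ^ 2 ≤ 2 * (p⁻¹ * (p * v s + w) ^ 2) + 2 * (p * v s ^ 2) := by
        have e : 2 * (p⁻¹ * (p * v s + w) ^ 2) + 2 * (p * v s ^ 2) - p⁻¹ * w ^ 2
          = p⁻¹ * (2 * p * v s + w) ^ 2 := by field_simp; ring
        have : 0 ≤ p⁻¹ * (2 * p * v s + w) ^ 2 := by positivity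
        linarith
      have e3 : 0 ≤ q ^ 2 := sq_nonneg _
      simp only [hB]
      change |g p * ρx s| ≤ p⁻¹ * (p * v s + w) ^ 2 + p * v s ^ 2 + Qf P ρs p
      rw [e1, ← hqq, abs_le]
      have e4 : 0 ≤ z ^ 2 - 2 * (z * q) + q ^ 2 := by
        have := sq_nonneg (z - q); rwa [sub_sq, mul_assoc] at this
      have e5 : 0 ≤ z ^ 2 + 2 * (z * q) + q ^ 2 := by
        have := sq_nonneg (z + q); rwa [add_sq, mul_assoc] at this
      rw [hzz] at e4 e5
      constructor <;> linarith only [e2, e3, e4, e5]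
    have iBxy : IntervalIntegrable B volume x y := iB.mono_set (by
      rw [hu, uIcc_of_le hxy]; exact hsub)
    calc |∫ s in x..y, g (ρ s) * ρx s| ≤ ∫ s in x..y, B s := by
          rw [← Real.norm_eq_abs]
          apply intervalIntegral.norm_integral_le_of_norm_le hxy _ iBxy
          refine Eventually.of_forall fun s hs => ?_
          exact hpt s (hsub ⟨hs.1.le, hs.2⟩)
      _ ≤ ∫ s in a..b, B s := by
          apply intervalIntegral.integral_mono_interval hx.1 hxy hy.2 _ iB
          refine (ae_restrict_iff' measurableSet_Ioc).2 (Eventually.of_forall fun s hs => ?_)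
          exact B0 s ⟨hs.1.le, hs.2⟩
      _ = IW + IE + IU := by
          rw [hIW, hIE, hIU, ← intervalIntegral.integral_add iw iv,
            ← intervalIntegral.integral_add (iw.add iv) iQ]
      _ ≤ K := by rw [hK]; linarith
  have key2 : ∀ x ∈ Icc a b, ∀ y ∈ Icc a b, Gf P μ ρs (ρ y) ≤ Gf P μ ρs (ρ x) + K := by
    intro x hx y hy
    rcases le_total x y with h | h
    · linarith [(abs_le.1 (key x hx y hy h)).2]
    · linarith [(abs_le.1 (key y hy x hx h)).1]
  have hbI : b ∈ Icc a b := right_mem_Icc.2 hab.le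
  -- endpoint bound
  have hρb : ρ b ≤ R' := by
    by_contra hcon
    push Not at hcon
    have := hR (ρ b) ((le_max_left R 1).trans hcon.le)
    have e1 := sq_nonneg (v b - 1)
    have e2 := sq_nonneg (v b - kf μ ρs (ρ b) + 1)
    rw [sub_sq] at e1
    rw [add_sq] at e2
    linarith only [e1, e2, this, bvb, bkb, hvS, hS]
  -- interior point
  have hex : ∃ y ∈ Icc a b, ε ≤ ρ y := by
    by_contra hcon
    push Not at hcon
    have iρ : IntervalIntegrable ρ volume a b :=
      ContinuousOn.intervalIntegrable (by rwa [hu])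
    have : ∫ x in a..b, (S + 1) * ρ x ≤ IU := by
      apply intervalIntegral.integral_mono_on hab.le (iρ.const_mul _) iQ
      intro x hx
      exact hεQ _ (hρ0 x hx) (hcon x hx)
    rw [intervalIntegral.integral_const_mul, hmass] at this
    linarith
  obtain ⟨y, hy, hεy⟩ := hex
  intro x hx
  constructor
  · apply (min_le_left _ _).trans
    by_contra hcon
    push Not at hcon
    have h3 : Gf P μ ρs (ρ x) < Gf P μ ρs ε - K := hδG ⟨hρ0 x hx, hcon⟩
    have h4 := hGmono hε (hρ0 y hy) hεy
    linarith [key2 x hx y hy]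
  · by_contra hcon
    push Not at hcon
    have h3 := hM (ρ x) ((le_max_left M 1).trans hcon.le)
    have h4 := hGmono (hρ0 b hbI) hR'0 hρb
    linarith [key2 b hbI x hx]
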